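/- Splitting on a shared conditional: let a and all terms in the families (a⃗ᵢ, b⃗ᵢ)ᵢ and (c⃗ⱼ, t⃗ⱼ)ⱼ be if-free and in R-normal form, with a ∉ a⃗ᵢ ∪ b⃗ᵢ ∪ c⃗ⱼ for all i, j. Let s ≡ B[(Cᵢ[a⃗ᵢ,a ⋄ b⃗ᵢ,a])ᵢ ⋄ (Dⱼ[c⃗ⱼ,a ⋄ t⃗ⱼ])ⱼ], where B, Cᵢ, Dⱼ are if-contexts, the guard holes of B are filled by the terms Cᵢ[a⃗ᵢ,a ⋄ b⃗ᵢ,a] and its leaf holes by Dⱼ[c⃗ⱼ,a ⋄ t⃗ⱼ]. If t ∈ leaves(s↓_R), then t ∈ leaves(s_true↓_R) or t ∈ leaves(s_false↓_R), where s_true (resp. s_false) is obtained from s by replacing every displayed occurrence of a by true (resp. false). -/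

import Mathlib

/-- The signature: pairing, decryption, projections, zero, key generation,
randomized encryption, equality test, if-then-else, booleans, countably many
adversarial symbols, names, plus auxiliary symbols (boxed conditionals, the
freezing symbol, and hole markers) used in some developments. -/
inductive FSym : Type
  | pair | dec | proj1 | proj2 | zero | pk | sk | enc | eq | ite | tt | ff
  | box | freeze
  | adv (i : ℕ)
  | name (n : ℕ)
  | hole (i : ℕ)
  deriving DecidableEq

/-- Ground terms over the signature. -/
inductive Tm : Type
  | app : FSym → List Tm → Tm

namespace Tm
def pairT (s t : Tm) : Tm := .app .pair [s, t]
def decT (s t : Tm) : Tm := .app .dec [s, t]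
def proj1T (s : Tm) : Tm := .app .proj1 [s]
def proj2T (s : Tm) : Tm := .app .proj2 [s]
def zeroT (s : Tm) : Tm := .app .zero [s]
def pkT (s : Tm) : Tm := .app .pk [s]
def skT (s : Tm) : Tm := .app .sk [s]
def encT (m k r : Tm) : Tm := .app .enc [m, k, r]
def eqT (s t : Tm) : Tm := .app .eq [s, t]
def iteT (b s t : Tm) : Tm := .app .ite [b, s, t]
def trueT : Tm := .app .tt []
def falseT : Tm := .app .ff []
def nameT (n : ℕ) : Tm := .app (.name n) []
def holeT (i : ℕ) : Tm := .app (.hole i) []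
def boxT (a b c : Tm) : Tm := .app .box [a, b, c]
def freezeT (b : Tm) : Tm := .app .freeze [b]
end Tm

open Tm

/-- A term is if-free if it contains no occurrence of if-then-else. -/
inductive IfFree : Tm → Prop
  | app {f : FSym} {ts : List Tm} (hf : f ≠ FSym.ite) (h : ∀ t ∈ ts, IfFree t) :
      IfFree (Tm.app f ts)

def IsIte (t : Tm) : Prop := ∃ b x y, t = iteT b x y

/-- The computation equations R1, oriented left-to-right. -/
inductive R1 : Tm → Tm → Prop
  | proj1 (x y : Tm) : R1 (proj1T (pairT x y)) x
  | proj2 (x y : Tm) : R1 (proj2T (pairT x y)) y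
  | decEnc (x y z : Tm) : R1 (decT (encT x (pkT y) z) (skT y)) x
  | eqRefl (x : Tm) : R1 (eqT x x) trueT

/-- The if-homomorphism equations R2, oriented left-to-right. -/
inductive R2 : Tm → Tm → Prop
  | homo (f : FSym) (hf : f ≠ FSym.ite) (l r : List Tm) (b x y : Tm) :
      R2 (.app f (l ++ iteT b x y :: r))
         (iteT b (.app f (l ++ x :: r)) (.app f (l ++ y :: r)))
  | guard (b a c x y : Tm) :
      R2 (iteT (iteT b a c) x y) (iteT b (iteT a x y) (iteT c x y))

/-- The if-simplification equations R3, oriented left-to-right. -/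
inductive R3 : Tm → Tm → Prop
  | same (b x : Tm) : R3 (iteT b x x) x
  | ifTrue (x y : Tm) : R3 (iteT trueT x y) x
  | ifFalse (x y : Tm) : R3 (iteT falseT x y) y
  | absorbThen (b x y z : Tm) : R3 (iteT b (iteT b x y) z) (iteT b x z)
  | absorbElse (b x y z : Tm) : R3 (iteT b x (iteT b y z)) (iteT b x z)

/-- The if-permutation equations R4 (as unoriented equations,
read here left-to-right; the oriented system restricts them). -/
inductive R4 : Tm → Tm → Prop
  | permThen (b a x y z : Tm) :
      R4 (iteT b (iteT a x y) z) (iteT a (iteT b x z) (iteT b y z))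
  | permElse (b a x y z : Tm) :
      R4 (iteT b x (iteT a y z)) (iteT a (iteT b x y) (iteT b x z))

/-- Closure of a root rewrite relation under contexts (one rewrite step). -/
inductive Step (root : Tm → Tm → Prop) : Tm → Tm → Prop
  | root {s t : Tm} : root s t → Step root s t
  | ctx {f : FSym} {l r : List Tm} {s t : Tm} :
      Step root s t → Step root (.app f (l ++ s :: r)) (.app f (l ++ t :: r))

def RRoot (s t : Tm) : Prop := R1 s t ∨ R2 s t ∨ R3 s t ∨ R4 s t

/-- The congruence =_R generated by the equations R = R1 ∪ R2 ∪ R3 ∪ R4. -/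
inductive REq : Tm → Tm → Prop
  | step {s t : Tm} : Step RRoot s t → REq s t
  | refl (t : Tm) : REq t t
  | symm {s t : Tm} : REq s t → REq t s
  | trans {s t u : Tm} : REq s t → REq t u → REq s u

/-- Irreducible for the computation rules R1.  (For an if-free term this is
exactly being in R-normal form, since all other rules of R involve an
if-then-else.) -/
def R1Nf (t : Tm) : Prop := ∀ s, ¬ Step R1 t s

/-- If-free conditionals in R-normal form. -/
def NfIfFree (t : Tm) : Prop := IfFree t ∧ R1Nf t

mutual
  /-- The lexicographic path ordering induced by the precedence `prec`
  (`prec f g` meaning f ≻ g): `LPO prec s t` means s ≻ t. -/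
  inductive LPO (prec : FSym → FSym → Prop) : Tm → Tm → Prop
    | subGt {f : FSym} {ss : List Tm} {t : Tm} (s : Tm) (hs : s ∈ ss)
        (h : LPO prec s t) : LPO prec (.app f ss) t
    | subEq {f : FSym} {ss : List Tm} {t : Tm} (hs : t ∈ ss) :
        LPO prec (.app f ss) t
    | lex {f : FSym} {ss ts : List Tm}
        (h1 : ∀ t ∈ ts, LPO prec (.app f ss) t)
        (h2 : LPOLex prec ss ts) : LPO prec (.app f ss) (.app f ts)
    | prec_ {f g : FSym} {ss ts : List Tm} (hfg : prec f g)
        (h : ∀ t ∈ ts, LPO prec (.app f ss) t) : LPO prec (.app f ss) (.app g ts)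

  /-- Lexicographic extension of the LPO to lists. -/
  inductive LPOLex (prec : FSym → FSym → Prop) : List Tm → List Tm → Prop
    | head {s t : Tm} {ss ts : List Tm} (h : LPO prec s t) :
        LPOLex prec (s :: ss) (t :: ts)
    | tail {s : Tm} {ss ts : List Tm} (h : LPOLex prec ss ts) :
        LPOLex prec (s :: ss) (s :: ts)
end

/-- `prec` is a total precedence on function symbols with if-then-else minimal. -/
def PrecOK (prec : FSym → FSym → Prop) : Prop :=
  (∀ f g h, prec f g → prec g h → prec f h) ∧
  (∀ f, ¬ prec f f) ∧
  (∀ f g, f ≠ g → prec f g ∨ prec g f) ∧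
  (∀ f, f ≠ FSym.ite → prec f FSym.ite)

/-- `su` is a total (strict) order on if-free conditionals in R-normal form. -/
def SuOK (su : Tm → Tm → Prop) : Prop :=
  (∀ a b c, su a b → su b c → su a c) ∧
  (∀ a, ¬ su a a) ∧
  (∀ a b, NfIfFree a → NfIfFree b → a ≠ b → su a b ∨ su b a)

/-- The ordering ≻_c on conditionals, combining the user-chosen total order
`su` on if-free R-normal conditionals with the LPO. -/
def CondGt (prec : FSym → FSym → Prop) (su : Tm → Tm → Prop) (b a : Tm) : Prop :=
  (NfIfFree a ∧ NfIfFree b ∧ su b a) ∨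
  (¬ NfIfFree a ∧ ¬ NfIfFree b ∧ LPO prec b a) ∨
  (NfIfFree a ∧ ¬ NfIfFree b)

/-- Root steps of the oriented rewrite system R^{≻u}: R1, R2, R3 oriented
left-to-right, and the ground instances of R4 oriented by ≻_c. -/
inductive ORoot (prec : FSym → FSym → Prop) (su : Tm → Tm → Prop) : Tm → Tm → Prop
  | r1 {s t : Tm} : R1 s t → ORoot prec su s t
  | r2 {s t : Tm} : R2 s t → ORoot prec su s t
  | r3 {s t : Tm} : R3 s t → ORoot prec su s t
  | permThen {b a x y z : Tm} (h : CondGt prec su b a) :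
      ORoot prec su (iteT b (iteT a x y) z) (iteT a (iteT b x z) (iteT b y z))
  | permElse {b a x y z : Tm} (h : CondGt prec su b a) :
      ORoot prec su (iteT b x (iteT a y z)) (iteT a (iteT b x y) (iteT b x z))

/-- One rewrite step of the oriented system →_{R^{≻u}}. -/
def RW (prec : FSym → FSym → Prop) (su : Tm → Tm → Prop) : Tm → Tm → Prop :=
  Step (ORoot prec su)

/-- `w` is the normal form of `t` for the oriented system. -/
def IsNfOf (prec : FSym → FSym → Prop) (su : Tm → Tm → Prop) (t w : Tm) : Prop :=
  Relation.ReflTransGen (RW prec su) t w ∧ ∀ s, ¬ RW prec su w s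

/-- `Leaf t u`: `u` is a leaf of the R-normal form term `t`
(seen through the grammar t ::= u | if b then t₁ else t₂). -/
inductive Leaf : Tm → Tm → Prop
  | base {t : Tm} (h : ¬ IsIte t) : Leaf t t
  | left {b x y u : Tm} (h : Leaf x u) : Leaf (iteT b x y) u
  | right {b x y u : Tm} (h : Leaf y u) : Leaf (iteT b x y) u

/-- `Cond t c`: `c` is one of the guard conditionals of `t`. -/
inductive Cond : Tm → Tm → Prop
  | here {b x y : Tm} : Cond (iteT b x y) b
  | left {b x y c : Tm} (h : Cond x c) : Cond (iteT b x y) c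
  | right {b x y c : Tm} (h : Cond y c) : Cond (iteT b x y) c

open Classical in
/-- Replace a term by `a'` when it equals `a`. -/
noncomputable def repTm (a a' t : Tm) : Tm := if t = a then a' else t

/-- If-trees with atomic guards and atomic leaves (representing if-contexts
C[a⃗ ⋄ b⃗] instantiated by if-free terms). -/
inductive DTree : Type
  | leaf : Tm → DTree
  | node : Tm → DTree → DTree → DTree

namespace DTree
def interp : DTree → Tm
  | leaf t => t
  | node g l r => iteT g l.interp r.interp

/-- Replace every guard and leaf atom equal to `a` by `a'`. -/
noncomputable def substAll (a a' : Tm) : DTree → DTree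
  | leaf t => leaf (repTm a a' t)
  | node g l r => node (repTm a a' g) (l.substAll a a') (r.substAll a a')

/-- Replace every guard atom equal to `a` by `a'` (leaving leaves unchanged). -/
noncomputable def substG (a a' : Tm) : DTree → DTree
  | leaf t => leaf t
  | node g l r => node (repTm a a' g) (l.substG a a') (r.substG a a')

def atoms : DTree → Set Tm
  | leaf t => {t}
  | node g l r => {g} ∪ l.atoms ∪ r.atoms
end DTree

/-- If-trees whose guards are (interpretations of) if-trees over atoms and
whose leaves are if-trees over atoms. -/
inductive BTree : Type
  | leaf : DTree → BTree
  | node : DTree → BTree → BTree → BTree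

namespace BTree
def interp : BTree → Tm
  | leaf d => d.interp
  | node c l r => iteT c.interp l.interp r.interp

/-- Replace the displayed occurrences of `a`: all occurrences among the atoms
of the guard trees, and the guard-atom occurrences of the leaf trees. -/
noncomputable def subst (a a' : Tm) : BTree → BTree
  | leaf d => leaf (d.substG a a')
  | node c l r => node (c.substAll a a') (l.subst a a') (r.subst a a')

def guards : BTree → Set DTree
  | leaf _ => ∅
  | node c l r => {c} ∪ l.guards ∪ r.guards

def leaves : BTree → Set DTree
  | leaf d => {d}
  | node _ l r => l.leaves ∪ r.leaves
end BTree

section Inversion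

theorem ifFree_app_iff {f : FSym} {ts : List Tm} :
    IfFree (.app f ts) ↔ f ≠ FSym.ite ∧ ∀ t ∈ ts, IfFree t :=
  ⟨fun h => by cases h with | app hf h => exact ⟨hf, h⟩, fun h => .app h.1 h.2⟩

theorem not_ifFree_iteT (b x y : Tm) : ¬ IfFree (iteT b x y) :=
  fun h => (ifFree_app_iff.1 h).1 rfl

theorem iteT_inj {b x y b' x' y' : Tm} :
    iteT b x y = iteT b' x' y' ↔ b = b' ∧ x = x' ∧ y = y' := by
  simp [iteT]

theorem not_r1_iteT {b x y s : Tm} : ¬ R1 (iteT b x y) s := by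
  intro h
  generalize e : iteT b x y = p at h
  cases h <;> simp [iteT, proj1T, proj2T, decT, eqT] at e

theorem step_iteT_inv {root : Tm → Tm → Prop} {b x y s : Tm} (h : Step root (iteT b x y) s) :
    root (iteT b x y) s ∨ (∃ b', Step root b b' ∧ s = iteT b' x y) ∨
      (∃ x', Step root x x' ∧ s = iteT b x' y) ∨ (∃ y', Step root y y' ∧ s = iteT b x y') := by
  generalize e : iteT b x y = p at h
  cases h with
  | root h => exact .inl h
  | @ctx f l r s t h =>
    simp only [iteT, Tm.app.injEq] at e
    obtain ⟨rfl, e⟩ := e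
    rcases l with _ | ⟨l₁, _ | ⟨l₂, _ | ⟨l₃, l⟩⟩⟩
    · simp only [List.nil_append, List.cons.injEq] at e
      obtain ⟨rfl, rfl⟩ := e
      exact .inr (.inl ⟨t, h, rfl⟩)
    · simp only [List.cons_append, List.nil_append, List.cons.injEq] at e
      obtain ⟨rfl, rfl, rfl⟩ := e
      exact .inr (.inr (.inl ⟨t, h, rfl⟩))
    · simp only [List.cons_append, List.nil_append, List.cons.injEq] at e
      obtain ⟨rfl, rfl, rfl, rfl⟩ := e
      exact .inr (.inr (.inr ⟨t, h, rfl⟩))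
    · simp at e

theorem Step.guard {root : Tm → Tm → Prop} {b b' : Tm} (x y : Tm) (h : Step root b b') :
    Step root (iteT b x y) (iteT b' x y) :=
  Step.ctx (f := .ite) (l := []) (r := [x, y]) h

theorem Step.thenBranch {root : Tm → Tm → Prop} {x x' : Tm} (b y : Tm) (h : Step root x x') :
    Step root (iteT b x y) (iteT b x' y) :=
  Step.ctx (f := .ite) (l := [b]) (r := [y]) h

theorem Step.elseBranch {root : Tm → Tm → Prop} {y y' : Tm} (b x : Tm) (h : Step root y y') :
    Step root (iteT b x y) (iteT b x y') :=
  Step.ctx (f := .ite) (l := [b, x]) (r := []) h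

theorem reflTransGen_iteT {root : Tm → Tm → Prop} {b b' x x' y y' : Tm}
    (hb : Relation.ReflTransGen (Step root) b b') (hx : Relation.ReflTransGen (Step root) x x')
    (hy : Relation.ReflTransGen (Step root) y y') :
    Relation.ReflTransGen (Step root) (iteT b x y) (iteT b' x' y') :=
  ((hb.lift (fun b => iteT b x y) fun _ _ h => h.guard x y).trans
    (hx.lift (fun x => iteT b' x y) fun _ _ h => h.thenBranch b' y)).trans
    (hy.lift (fun y => iteT b' x' y) fun _ _ h => h.elseBranch b' x')

theorem nfIfFree_const {f : FSym} (h₁ : f ≠ .ite) (h₂ : f ≠ .proj1) (h₃ : f ≠ .proj2)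
    (h₄ : f ≠ .dec) (h₅ : f ≠ .eq) : NfIfFree (.app f []) := by
  refine ⟨.app h₁ (by simp), fun s h => ?_⟩
  generalize e : Tm.app f [] = p at h
  cases h with
  | root h => cases h <;> simp_all [proj1T, proj2T, decT, eqT]
  | ctx h => simp at e

theorem nfIfFree_trueT : NfIfFree trueT := nfIfFree_const nofun nofun nofun nofun nofun

theorem nfIfFree_falseT : NfIfFree falseT := nfIfFree_const nofun nofun nofun nofun nofun

end Inversion

/-- Terms built with if-then-else from if-free terms in R-normal form. -/
inductive IteTerm : Tm → Prop
  | atom {t : Tm} (h : NfIfFree t) : IteTerm t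
  | node {b x y : Tm} (hb : IteTerm b) (hx : IteTerm x) (hy : IteTerm y) : IteTerm (iteT b x y)

theorem iteTerm_iteT_iff {b x y : Tm} :
    IteTerm (iteT b x y) ↔ IteTerm b ∧ IteTerm x ∧ IteTerm y := by
  refine ⟨fun h => ?_, fun h => .node h.1 h.2.1 h.2.2⟩
  generalize e : iteT b x y = p at h
  cases h with
  | atom h => exact absurd (e ▸ h.1) (not_ifFree_iteT _ _ _)
  | node hb hx hy =>
    obtain ⟨rfl, rfl, rfl⟩ := iteT_inj.1 e
    exact ⟨hb, hx, hy⟩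

theorem IteTerm.nfIfFree {f : FSym} {ts : List Tm} (h : IteTerm (.app f ts)) (hf : f ≠ .ite) :
    NfIfFree (.app f ts) := by
  generalize e : Tm.app f ts = p at h
  cases h with
  | atom h => exact h
  | node => simp [iteT, hf] at e

/-- The value of a term when the if-free conditionals are decided by `v`. -/
def evalTm (v : Tm → Bool) : Tm → Tm
  | .app .ite [b, x, y] => bif v (evalTm v b) then evalTm v x else evalTm v y
  | t => t

theorem evalTm_iteT (v : Tm → Bool) (b x y : Tm) :
    evalTm v (iteT b x y) = bif v (evalTm v b) then evalTm v x else evalTm v y := by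
  simp [iteT, evalTm]

theorem evalTm_of_ifFree (v : Tm → Bool) {t : Tm} (h : IfFree t) : evalTm v t = t := by
  unfold evalTm
  split
  · exact absurd h (not_ifFree_iteT _ _ _)
  · rfl

/-- A valuation that interprets the boolean constants as expected. -/
def BoolVal (v : Tm → Bool) : Prop := v trueT = true ∧ v falseT = false

section Rewriting

variable {prec : FSym → FSym → Prop} {su : Tm → Tm → Prop}

theorem not_rw_of_nfIfFree {t s : Tm} (ht : NfIfFree t) : ¬ RW prec su t s := by
  intro h
  induction h with
  | root h =>
    cases h with
    | r1 h => exact ht.2 _ (.root h)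
    | r2 h =>
      cases h with
      | homo => exact not_ifFree_iteT _ _ _ ((ifFree_app_iff.1 ht.1).2 _ List.mem_append_cons_self)
      | guard => exact not_ifFree_iteT _ _ _ ht.1
    | r3 h => cases h <;> exact not_ifFree_iteT _ _ _ ht.1
    | permThen => exact not_ifFree_iteT _ _ _ ht.1
    | permElse => exact not_ifFree_iteT _ _ _ ht.1
  | ctx _ ih => exact ih ⟨(ifFree_app_iff.1 ht.1).2 _ (by simp), fun u hu => ht.2 _ (.ctx hu)⟩

theorem oRoot_preserves {s t : Tm} (h : ORoot prec su s t) (hs : IteTerm s) :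
    IteTerm t ∧ ∀ v, BoolVal v → evalTm v t = evalTm v s := by
  cases h with
  | r1 h =>
    have hnf : NfIfFree s := by
      cases h <;> exact hs.nfIfFree nofun
    exact absurd (.root h) (hnf.2 _)
  | r2 h =>
    cases h with
    | homo f hf =>
      exact absurd ((ifFree_app_iff.1 (hs.nfIfFree hf).1).2 _ List.mem_append_cons_self)
        (not_ifFree_iteT _ _ _)
    | guard b a c x y =>
      simp only [iteTerm_iteT_iff] at hs ⊢
      refine ⟨by tauto, fun v _ => ?_⟩
      simp only [evalTm_iteT]
      cases v (evalTm v b) <;> rfl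
  | r3 h =>
    cases h with
    | same b x =>
      simp only [iteTerm_iteT_iff] at hs
      exact ⟨hs.2.1, fun v _ => by simp [evalTm_iteT]⟩
    | ifTrue x y =>
      simp only [iteTerm_iteT_iff] at hs
      exact ⟨hs.2.1, fun v hv => by
        simp [evalTm_iteT, evalTm_of_ifFree v nfIfFree_trueT.1, hv.1]⟩
    | ifFalse x y =>
      simp only [iteTerm_iteT_iff] at hs
      exact ⟨hs.2.2, fun v hv => by
        simp [evalTm_iteT, evalTm_of_ifFree v nfIfFree_falseT.1, hv.2]⟩
    | absorbThen b x y z =>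
      simp only [iteTerm_iteT_iff] at hs ⊢
      refine ⟨by tauto, fun v _ => ?_⟩
      simp only [evalTm_iteT]
      cases v (evalTm v b) <;> rfl
    | absorbElse b x y z =>
      simp only [iteTerm_iteT_iff] at hs ⊢
      refine ⟨by tauto, fun v _ => ?_⟩
      simp only [evalTm_iteT]
      cases v (evalTm v b) <;> rfl
  | @permThen b a x y z =>
    simp only [iteTerm_iteT_iff] at hs ⊢
    refine ⟨by tauto, fun v _ => ?_⟩
    simp only [evalTm_iteT]
    cases v (evalTm v b) <;> cases v (evalTm v a) <;> rfl
  | @permElse b a x y z =>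
    simp only [iteTerm_iteT_iff] at hs ⊢
    refine ⟨by tauto, fun v _ => ?_⟩
    simp only [evalTm_iteT]
    cases v (evalTm v b) <;> cases v (evalTm v a) <;> rfl

theorem rw_preserves {s t : Tm} (h : RW prec su s t) (hs : IteTerm s) :
    IteTerm t ∧ ∀ v, BoolVal v → evalTm v t = evalTm v s := by
  induction hs generalizing t with
  | atom hs => exact absurd h (not_rw_of_nfIfFree hs)
  | node hb hx hy ihb ihx ihy =>
    have inv := step_iteT_inv h
    clear h
    rcases inv with h | ⟨_, h, rfl⟩ | ⟨_, h, rfl⟩ | ⟨_, h, rfl⟩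
    · exact oRoot_preserves h (.node hb hx hy)
    · exact ⟨.node (ihb h).1 hx hy, fun v hv => by simp only [evalTm_iteT, (ihb h).2 v hv]⟩
    · exact ⟨.node hb (ihx h).1 hy, fun v hv => by simp only [evalTm_iteT, (ihx h).2 v hv]⟩
    · exact ⟨.node hb hx (ihy h).1, fun v hv => by simp only [evalTm_iteT, (ihy h).2 v hv]⟩

theorem reflTransGen_rw_preserves {s t : Tm} (h : Relation.ReflTransGen (RW prec su) s t)
    (hs : IteTerm s) : IteTerm t ∧ ∀ v, BoolVal v → evalTm v t = evalTm v s := by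
  induction h with
  | refl => exact ⟨hs, fun _ _ => rfl⟩
  | tail _ h ih =>
    have := rw_preserves h ih.1
    exact ⟨this.1, fun v hv => (this.2 v hv).trans (ih.2 v hv)⟩

theorem leaf_evalTm (v : Tm → Bool) {t : Tm} (ht : IteTerm t) : Leaf t (evalTm v t) := by
  induction ht with
  | @atom t h =>
    rw [evalTm_of_ifFree v h.1]
    refine .base ?_
    rintro ⟨b, x, y, rfl⟩
    exact not_ifFree_iteT _ _ _ h.1
  | @node b x y _ _ _ _ ihx ihy =>
    rw [evalTm_iteT]
    cases v (evalTm v b)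
    · exact .right ihy
    · exact .left ihx

namespace DTree

/-- The guards of an if-tree. -/
def guardSet : DTree → Set Tm
  | leaf _ => ∅
  | node g l r => {g} ∪ l.guardSet ∪ r.guardSet

/-- Every guard of the tree is strictly above `c`. -/
def Above (su : Tm → Tm → Prop) (c : Tm) (d : DTree) : Prop := ∀ h ∈ d.guardSet, su h c

/-- Reduced ordered decision trees: the guards strictly increase along every branch, are
different from the boolean constants, and no node has two equal branches. -/
def Reduced (su : Tm → Tm → Prop) : DTree → Prop
  | leaf t => NfIfFree t
  | node g l r => NfIfFree g ∧ g ≠ trueT ∧ g ≠ falseT ∧ l.Above su g ∧ r.Above su g ∧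
      l.interp ≠ r.interp ∧ l.Reduced su ∧ r.Reduced su

theorem Above.trans (hsu : SuOK su) {b c : Tm} {d : DTree} (h : d.Above su b) (hbc : su b c) :
    d.Above su c :=
  fun g hg => hsu.1 _ _ _ (h g hg) hbc

theorem above_node (hsu : SuOK su) {c g : Tm} {l r : DTree} (hl : l.Above su g)
    (hr : r.Above su g) (h : su g c) : (node g l r).Above su c := by
  rintro x ((rfl | hx) | hx)
  · exact h
  · exact hl.trans hsu h x hx
  · exact hr.trans hsu h x hx

theorem Above.mono_of_subset {b c : Tm} {d l r : DTree}
    (h : d.guardSet ⊆ {b} ∪ l.guardSet ∪ r.guardSet) (hb : su b c) (hl : l.Above su c)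
    (hr : r.Above su c) : d.Above su c := by
  intro x hx
  rcases h hx with (rfl | hx) | hx
  · exact hb
  · exact hl x hx
  · exact hr x hx

theorem Reduced.trichotomy (hsu : SuOK su) {c : Tm} (hc : NfIfFree c) {d : DTree}
    (hd : d.Reduced su) :
    d.Above su c ∨ (∃ l r, d = node c l r) ∨ ∃ g l r, d = node g l r ∧ su c g := by
  cases d with
  | leaf t => exact .inl (by simp [Above, guardSet])
  | node g l r =>
    obtain ⟨hg, -, -, hl, hr, -⟩ := hd
    by_cases h : g = c
    · exact .inr (.inl ⟨l, r, by rw [h]⟩)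
    · rcases hsu.2.2 g c hg hc h with h | h
      · exact .inl (above_node hsu hl hr h)
      · exact .inr (.inr ⟨g, l, r, rfl, h⟩)

theorem Reduced.iteTerm {d : DTree} (hd : d.Reduced su) : IteTerm d.interp := by
  induction d with
  | leaf t => exact .atom hd
  | node g l r ihl ihr =>
    obtain ⟨hg, -, -, -, -, -, hl, hr⟩ := hd
    exact .node (.atom hg) (ihl hl) (ihr hr)

theorem Reduced.exists_eq_node {d : DTree} (hd : d.Reduced su) {b x y : Tm}
    (h : d.interp = iteT b x y) : NfIfFree b ∧ b ∈ d.guardSet := by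
  cases d with
  | leaf t => exact absurd hd.1 (by rw [show t = _ from h]; exact not_ifFree_iteT _ _ _)
  | node g l r =>
    obtain ⟨rfl, -, -⟩ := iteT_inj.1 h
    exact ⟨hd.1, .inl (.inl rfl)⟩

theorem su_of_condGt {b a : Tm} (hb : NfIfFree b) (ha : NfIfFree a) (h : CondGt prec su b a) :
    su b a := by
  rcases h with h | h | h
  · exact h.2.2
  · exact absurd ha h.1
  · exact absurd hb h.2

theorem Reduced.not_rw (hsu : SuOK su) {d : DTree} (hd : d.Reduced su) (s : Tm) :
    ¬ RW prec su d.interp s := by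
  induction d generalizing s with
  | leaf t => exact not_rw_of_nfIfFree hd
  | node g l r ihl ihr =>
    obtain ⟨hg, htt, hff, hal, har, hne, hl, hr⟩ := hd
    intro h
    have inv := step_iteT_inv h
    clear h
    rcases inv with h | ⟨_, h, -⟩ | ⟨_, h, -⟩ | ⟨_, h, -⟩
    · generalize e : iteT g l.interp r.interp = p at h
      cases h with
      | r1 h => exact not_r1_iteT (e ▸ h)
      | r2 h =>
        cases h with
        | homo f hf => simp only [iteT, Tm.app.injEq] at e; exact hf e.1.symm
        | guard =>
          obtain ⟨rfl, -, -⟩ := iteT_inj.1 e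
          exact not_ifFree_iteT _ _ _ hg.1
      | r3 h =>
        cases h with
        | same => exact hne ((iteT_inj.1 e).2.1.trans (iteT_inj.1 e).2.2.symm)
        | ifTrue => exact htt (iteT_inj.1 e).1
        | ifFalse => exact hff (iteT_inj.1 e).1
        | absorbThen =>
          obtain ⟨rfl, e, -⟩ := iteT_inj.1 e
          exact hsu.2.1 _ (hal _ (hl.exists_eq_node e).2)
        | absorbElse =>
          obtain ⟨rfl, -, e⟩ := iteT_inj.1 e
          exact hsu.2.1 _ (har _ (hr.exists_eq_node e).2)
      | permThen hgt =>
        obtain ⟨rfl, e, -⟩ := iteT_inj.1 e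
        obtain ⟨ha, hmem⟩ := hl.exists_eq_node e
        exact hsu.2.1 _ (hsu.1 _ _ _ (hal _ hmem) (su_of_condGt hg ha hgt))
      | permElse hgt =>
        obtain ⟨rfl, -, e⟩ := iteT_inj.1 e
        obtain ⟨ha, hmem⟩ := hr.exists_eq_node e
        exact hsu.2.1 _ (hsu.1 _ _ _ (har _ hmem) (su_of_condGt hg ha hgt))
    · exact not_rw_of_nfIfFree hg h
    · exact ihl hl _ h
    · exact ihr hr _ h

theorem exists_reduced_of_above {b : Tm} (hb : NfIfFree b) (htt : b ≠ trueT) (hff : b ≠ falseT)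
    {l r : DTree} (hl : l.Reduced su) (hr : r.Reduced su) (hal : l.Above su b)
    (har : r.Above su b) :
    ∃ d : DTree, d.Reduced su ∧
      Relation.ReflTransGen (RW prec su) (iteT b l.interp r.interp) d.interp ∧
      d.guardSet ⊆ {b} ∪ l.guardSet ∪ r.guardSet := by
  by_cases h : l.interp = r.interp
  · refine ⟨l, hl, .single (.root (.r3 ?_)), fun x hx => .inl (.inr hx)⟩
    rw [← h]
    exact .same _ _
  · exact ⟨node b l r, ⟨hb, htt, hff, hal, har, h, hl, hr⟩, .refl, subset_rfl⟩

theorem exists_reduced_iteT_atom (hsu : SuOK su) {b : Tm} (hb : NfIfFree b) {l r : DTree}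
    (hl : l.Reduced su) (hr : r.Reduced su) :
    ∃ d : DTree, d.Reduced su ∧
      Relation.ReflTransGen (RW prec su) (iteT b l.interp r.interp) d.interp ∧
      d.guardSet ⊆ {b} ∪ l.guardSet ∪ r.guardSet := by
  by_cases htt : b = trueT
  · subst htt
    exact ⟨l, hl, .single (.root (.r3 (.ifTrue _ _))), fun x hx => .inl (.inr hx)⟩
  by_cases hff : b = falseT
  · subst hff
    exact ⟨r, hr, .single (.root (.r3 (.ifFalse _ _))), fun x hx => .inr hx⟩
  induction hn : sizeOf l + sizeOf r using Nat.strong_induction_on generalizing l r with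
  | _ n ih =>
    subst hn
    -- Once `c` has been moved to the root, the two branches are treated recursively.
    have combine : ∀ {c : Tm} {l₁ r₁ l₂ r₂ : DTree}, NfIfFree c → c ≠ trueT → c ≠ falseT →
        su b c → l₁.Reduced su → r₁.Reduced su → l₂.Reduced su → r₂.Reduced su →
        l₁.Above su c → r₁.Above su c → l₂.Above su c → r₂.Above su c →
        sizeOf l₁ + sizeOf r₁ < sizeOf l + sizeOf r →
        sizeOf l₂ + sizeOf r₂ < sizeOf l + sizeOf r →
        {c} ∪ l₁.guardSet ∪ r₁.guardSet ∪ l₂.guardSet ∪ r₂.guardSet ⊆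
          l.guardSet ∪ r.guardSet →
        Relation.ReflTransGen (RW prec su) (iteT b l.interp r.interp)
          (iteT c (iteT b l₁.interp r₁.interp) (iteT b l₂.interp r₂.interp)) →
        ∃ d : DTree, d.Reduced su ∧
          Relation.ReflTransGen (RW prec su) (iteT b l.interp r.interp) d.interp ∧
          d.guardSet ⊆ {b} ∪ l.guardSet ∪ r.guardSet := by
      intro c l₁ r₁ l₂ r₂ hc hct hcf hbc hl₁ hr₁ hl₂ hr₂ al₁ ar₁ al₂ ar₂ s₁ s₂ hsub hred
      obtain ⟨d₁, hd₁, e₁, g₁⟩ := ih _ s₁ hl₁ hr₁ rfl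
      obtain ⟨d₂, hd₂, e₂, g₂⟩ := ih _ s₂ hl₂ hr₂ rfl
      obtain ⟨d, hd, e, g⟩ := exists_reduced_of_above (prec := prec) hc hct hcf hd₁ hd₂
        (.mono_of_subset g₁ hbc al₁ ar₁) (.mono_of_subset g₂ hbc al₂ ar₂)
      refine ⟨d, hd, (hred.trans (reflTransGen_iteT .refl e₁ e₂)).trans e, fun x hx => ?_⟩
      have h₀ := @g x hx
      have h₁ := @g₁ x
      have h₂ := @g₂ x
      have h₃ := @hsub x
      simp only [Set.mem_union] at h₀ h₁ h₂ h₃ ⊢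
      tauto
    rcases hl.trichotomy hsu hb with al | ⟨l₁, l₂, rfl⟩ | ⟨c, l₁, l₂, rfl, hbc⟩
    · rcases hr.trichotomy hsu hb with ar | ⟨r₁, r₂, rfl⟩ | ⟨c, r₁, r₂, rfl, hbc⟩
      · exact exists_reduced_of_above hb htt hff hl hr al ar
      · obtain ⟨-, -, -, -, -, -, -, hr₂⟩ := hr
        obtain ⟨d, hd, e, g⟩ := ih _ (by simp only [node.sizeOf_spec]; omega) hl hr₂ rfl
        refine ⟨d, hd, .head (.root (.r3 (.absorbElse _ _ _ _))) e, fun x hx => ?_⟩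
        have := @g x hx
        simp only [guardSet, Set.mem_union] at this ⊢
        tauto
      · obtain ⟨hc, hct, hcf, ar₁, ar₂, -, hr₁, hr₂⟩ := hr
        have al := al.trans hsu hbc
        refine combine hc hct hcf hbc hl hr₁ hl hr₂ al ar₁ al ar₂
          (by simp only [node.sizeOf_spec]; omega) (by simp only [node.sizeOf_spec]; omega)
          (fun x => by simp only [guardSet, Set.mem_union]; tauto)
          (.single (.root (.permElse (.inl ⟨hc, hb, hbc⟩))))
    · obtain ⟨-, -, -, -, -, -, hl₁, -⟩ := hl
      obtain ⟨d, hd, e, g⟩ := ih _ (by simp only [node.sizeOf_spec]; omega) hl₁ hr rfl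
      refine ⟨d, hd, .head (.root (.r3 (.absorbThen _ _ _ _))) e, fun x hx => ?_⟩
      have := @g x hx
      simp only [guardSet, Set.mem_union] at this ⊢
      tauto
    · have hl' := hl
      obtain ⟨hc, hct, hcf, al₁, al₂, -, hl₁, hl₂⟩ := hl
      rcases hr.trichotomy hsu hc with ar | ⟨r₁, r₂, rfl⟩ | ⟨c', r₁, r₂, rfl, hcc⟩
      · exact combine hc hct hcf hbc hl₁ hr hl₂ hr al₁ ar al₂ ar
          (by simp only [node.sizeOf_spec]; omega) (by simp only [node.sizeOf_spec]; omega)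
          (fun x => by simp only [guardSet, Set.mem_union]; tauto)
          (.single (.root (.permThen (.inl ⟨hc, hb, hbc⟩))))
      · obtain ⟨-, -, -, ar₁, ar₂, -, hr₁, hr₂⟩ := hr
        refine combine hc hct hcf hbc hl₁ hr₁ hl₂ hr₂ al₁ ar₁ al₂ ar₂
          (by simp only [node.sizeOf_spec]; omega) (by simp only [node.sizeOf_spec]; omega)
          (fun x => by simp only [guardSet, Set.mem_union]; tauto) ?_
        have hgt : CondGt prec su b c := .inl ⟨hc, hb, hbc⟩
        exact .head (.root (.permThen hgt)) (.head (.thenBranch _ _ (.root (.permElse hgt)))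
          (.head (.elseBranch _ _ (.root (.permElse hgt)))
          (.head (.root (.r3 (.absorbThen _ _ _ _)))
          (.single (.root (.r3 (.absorbElse _ _ _ _)))))))
      · obtain ⟨hc', hct', hcf', ar₁, ar₂, -, hr₁, hr₂⟩ := hr
        have al := above_node hsu al₁ al₂ hcc
        have hbc' := hsu.1 _ _ _ hbc hcc
        exact combine hc' hct' hcf' hbc' hl' hr₁ hl' hr₂ al ar₁ al ar₂
          (by simp only [node.sizeOf_spec]; omega) (by simp only [node.sizeOf_spec]; omega)
          (fun x => by simp only [guardSet, Set.mem_union]; tauto)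
          (.single (.root (.permElse (.inl ⟨hc', hb, hbc'⟩))))

theorem exists_reduced_iteT (hsu : SuOK su) {b l r : DTree} (hb : b.Reduced su)
    (hl : l.Reduced su) (hr : r.Reduced su) :
    ∃ d : DTree, d.Reduced su ∧
      Relation.ReflTransGen (RW prec su) (iteT b.interp l.interp r.interp) d.interp := by
  induction b with
  | leaf b =>
    obtain ⟨d, hd, e, -⟩ := exists_reduced_iteT_atom (prec := prec) hsu hb hl hr
    exact ⟨d, hd, e⟩
  | node b b₁ b₂ ih₁ ih₂ =>
    obtain ⟨hb, -, -, -, -, -, hb₁, hb₂⟩ := hb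
    obtain ⟨d₁, hd₁, e₁⟩ := ih₁ hb₁
    obtain ⟨d₂, hd₂, e₂⟩ := ih₂ hb₂
    obtain ⟨d, hd, e, -⟩ := exists_reduced_iteT_atom (prec := prec) hsu hb hd₁ hd₂
    exact ⟨d, hd, .head (.root (.r2 (.guard _ _ _ _ _)))
      ((reflTransGen_iteT .refl e₁ e₂).trans e)⟩

theorem Reduced.exists_evalTm_eq (hsu : SuOK su) {d : DTree} (hd : d.Reduced su) {t : Tm}
    (ht : Leaf d.interp t) (v : Tm → Bool) (hv : BoolVal v) :
    ∃ v', BoolVal v' ∧ (∀ x ∉ d.guardSet, v' x = v x) ∧ evalTm v' d.interp = t := by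
  classical
  induction d generalizing v with
  | leaf u =>
    refine ⟨v, hv, fun _ _ => rfl, ?_⟩
    have hu : IfFree u := hd.1
    rw [interp] at ht ⊢
    cases ht with
    | base => exact evalTm_of_ifFree v hu
    | left => exact absurd hu (not_ifFree_iteT _ _ _)
    | right => exact absurd hu (not_ifFree_iteT _ _ _)
  | node g l r ihl ihr =>
    obtain ⟨hg, htt, hff, hal, har, -, hl, hr⟩ := hd
    have hupd : ∀ c, BoolVal (Function.update v g c) := fun c =>
      ⟨by rw [Function.update_of_ne htt.symm, hv.1], by rw [Function.update_of_ne hff.symm, hv.2]⟩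
    rw [interp] at ht ⊢
    generalize e : iteT g l.interp r.interp = p at ht
    cases ht with
    | base h => exact absurd ⟨_, _, _, e.symm⟩ h
    | left h =>
      obtain ⟨rfl, rfl, rfl⟩ := iteT_inj.1 e
      obtain ⟨v', hv', hag, hev⟩ := ihl hl h _ (hupd true)
      refine ⟨v', hv', fun x hx => ?_, ?_⟩
      · simp only [guardSet, Set.mem_union, Set.mem_singleton_iff, not_or] at hx
        rw [hag x hx.1.2, Function.update_of_ne hx.1.1]
      · rw [evalTm_iteT, evalTm_of_ifFree v' hg.1, hag g fun h => hsu.2.1 _ (hal g h)]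
        simpa using hev
    | right h =>
      obtain ⟨rfl, rfl, rfl⟩ := iteT_inj.1 e
      obtain ⟨v', hv', hag, hev⟩ := ihr hr h _ (hupd false)
      refine ⟨v', hv', fun x hx => ?_, ?_⟩
      · simp only [guardSet, Set.mem_union, Set.mem_singleton_iff, not_or] at hx
        rw [hag x hx.2, Function.update_of_ne hx.1.1]
      · rw [evalTm_iteT, evalTm_of_ifFree v' hg.1, hag g fun h => hsu.2.1 _ (har g h)]
        simpa using hev

end DTree

open DTree

theorem IteTerm.exists_reduced (hsu : SuOK su) {t : Tm} (ht : IteTerm t) :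
    ∃ d : DTree, d.Reduced su ∧ Relation.ReflTransGen (RW prec su) t d.interp := by
  induction ht with
  | @atom t h => exact ⟨.leaf t, h, .refl⟩
  | node _ _ _ ihb ihx ihy =>
    obtain ⟨b, hb, eb⟩ := ihb
    obtain ⟨x, hx, ex⟩ := ihx
    obtain ⟨y, hy, ey⟩ := ihy
    obtain ⟨d, hd, e⟩ := exists_reduced_iteT (prec := prec) hsu hb hx hy
    exact ⟨d, hd, (reflTransGen_iteT eb ex ey).trans e⟩

/-- An irreducible if-term is its own reduced tree. -/
theorem IteTerm.exists_reduced_eq (hsu : SuOK su) {t : Tm} (ht : IteTerm t)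
    (hnf : ∀ s, ¬ RW prec su t s) : ∃ d : DTree, d.Reduced su ∧ t = d.interp := by
  obtain ⟨d, hd, e⟩ := ht.exists_reduced (prec := prec) hsu
  rcases e.cases_head with e | ⟨s, h, -⟩
  · exact ⟨d, hd, e⟩
  · exact absurd h (hnf s)

end Rewriting

section Substitution

theorem nfIfFree_repTm {a a' t : Tm} (ha' : NfIfFree a') (ht : NfIfFree t) :
    NfIfFree (repTm a a' t) := by
  unfold repTm
  split <;> assumption

theorem val_repTm {v : Tm → Bool} {a a' : Tm} (h : v a' = v a) (t : Tm) :
    v (repTm a a' t) = v t := by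
  unfold repTm
  split
  next e => rw [h, e]
  · rfl

namespace DTree

theorem iteTerm_interp {d : DTree} (h : ∀ x ∈ d.atoms, NfIfFree x) : IteTerm d.interp := by
  induction d with
  | leaf t => exact .atom (h t rfl)
  | node g l r ihl ihr =>
    exact .node (.atom (h g (.inl (.inl rfl)))) (ihl fun x hx => h x (.inl (.inr hx)))
      (ihr fun x hx => h x (.inr hx))

theorem nfIfFree_atoms_substAll {a a' : Tm} (ha' : NfIfFree a') {d : DTree}
    (h : ∀ x ∈ d.atoms, NfIfFree x) : ∀ x ∈ (d.substAll a a').atoms, NfIfFree x := by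
  induction d with
  | leaf t => rintro x rfl; exact nfIfFree_repTm ha' (h t rfl)
  | node g l r ihl ihr =>
    rintro x ((rfl | hx) | hx)
    · exact nfIfFree_repTm ha' (h g (.inl (.inl rfl)))
    · exact ihl (fun x hx => h x (.inl (.inr hx))) x hx
    · exact ihr (fun x hx => h x (.inr hx)) x hx

theorem nfIfFree_atoms_substG {a a' : Tm} (ha' : NfIfFree a') {d : DTree}
    (h : ∀ x ∈ d.atoms, NfIfFree x) : ∀ x ∈ (d.substG a a').atoms, NfIfFree x := by
  induction d with
  | leaf t => exact h
  | node g l r ihl ihr =>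
    rintro x ((rfl | hx) | hx)
    · exact nfIfFree_repTm ha' (h g (.inl (.inl rfl)))
    · exact ihl (fun x hx => h x (.inl (.inr hx))) x hx
    · exact ihr (fun x hx => h x (.inr hx)) x hx

theorem val_evalTm_substAll {v : Tm → Bool} {a a' : Tm} (ha' : NfIfFree a') (hv : v a' = v a)
    {d : DTree} (h : ∀ x ∈ d.atoms, NfIfFree x) :
    v (evalTm v (d.substAll a a').interp) = v (evalTm v d.interp) := by
  induction d with
  | leaf t =>
    have ht : NfIfFree t := h t rfl
    simp only [substAll, interp]
    rw [evalTm_of_ifFree v ht.1, evalTm_of_ifFree v (nfIfFree_repTm ha' ht).1, val_repTm hv]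
  | node g l r ihl ihr =>
    have hg : NfIfFree g := h g (.inl (.inl rfl))
    have hl := ihl fun x hx => h x (.inl (.inr hx))
    have hr := ihr fun x hx => h x (.inr hx)
    simp only [substAll, interp, evalTm_iteT]
    rw [evalTm_of_ifFree v hg.1, evalTm_of_ifFree v (nfIfFree_repTm ha' hg).1, val_repTm hv]
    cases v g
    · exact hr
    · exact hl

theorem evalTm_substG {v : Tm → Bool} {a a' : Tm} (ha' : NfIfFree a') (hv : v a' = v a)
    {d : DTree} (h : ∀ x ∈ d.atoms, NfIfFree x) :
    evalTm v (d.substG a a').interp = evalTm v d.interp := by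
  induction d with
  | leaf t => rfl
  | node g l r ihl ihr =>
    have hg : NfIfFree g := h g (.inl (.inl rfl))
    simp only [substG, interp, evalTm_iteT]
    rw [evalTm_of_ifFree v hg.1, evalTm_of_ifFree v (nfIfFree_repTm ha' hg).1, val_repTm hv,
      ihl fun x hx => h x (.inl (.inr hx)), ihr fun x hx => h x (.inr hx)]

end DTree

namespace BTree

/-- All atoms of the tree are if-free and in R-normal form. -/
def NfAtoms (B : BTree) : Prop :=
  ∀ d : DTree, (d ∈ B.guards ∨ d ∈ B.leaves) → ∀ x ∈ d.atoms, NfIfFree x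

theorem nfAtoms_leaf {d : DTree} : (leaf d).NfAtoms ↔ ∀ x ∈ d.atoms, NfIfFree x := by
  simp [NfAtoms, guards, leaves]

theorem nfAtoms_node {c : DTree} {l r : BTree} :
    (node c l r).NfAtoms ↔ (∀ x ∈ c.atoms, NfIfFree x) ∧ l.NfAtoms ∧ r.NfAtoms := by
  refine ⟨fun h => ⟨h c (.inl (.inl (.inl rfl))), fun d hd => h d ?_, fun d hd => h d ?_⟩, ?_⟩
  · exact hd.imp (fun h => .inl (.inr h)) .inl
  · exact hd.imp .inr .inr
  · rintro ⟨hc, hl, hr⟩ d (((rfl | hd) | hd) | (hd | hd))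
    · exact hc
    · exact hl d (.inl hd)
    · exact hr d (.inl hd)
    · exact hl d (.inr hd)
    · exact hr d (.inr hd)

theorem NfAtoms.iteTerm {B : BTree} (h : B.NfAtoms) : IteTerm B.interp := by
  induction B with
  | leaf d => exact DTree.iteTerm_interp (nfAtoms_leaf.1 h)
  | node c l r ihl ihr =>
    obtain ⟨hc, hl, hr⟩ := nfAtoms_node.1 h
    exact .node (DTree.iteTerm_interp hc) (ihl hl) (ihr hr)

theorem NfAtoms.subst {a a' : Tm} (ha' : NfIfFree a') {B : BTree} (h : B.NfAtoms) :
    (B.subst a a').NfAtoms := by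
  induction B with
  | leaf d => exact nfAtoms_leaf.2 (DTree.nfIfFree_atoms_substG ha' (nfAtoms_leaf.1 h))
  | node c l r ihl ihr =>
    obtain ⟨hc, hl, hr⟩ := nfAtoms_node.1 h
    exact nfAtoms_node.2 ⟨DTree.nfIfFree_atoms_substAll ha' hc, ihl hl, ihr hr⟩

theorem NfAtoms.evalTm_subst {v : Tm → Bool} {a a' : Tm} (ha' : NfIfFree a') (hv : v a' = v a)
    {B : BTree} (h : B.NfAtoms) : evalTm v (B.subst a a').interp = evalTm v B.interp := by
  induction B with
  | leaf d => exact DTree.evalTm_substG ha' hv (nfAtoms_leaf.1 h)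
  | node c l r ihl ihr =>
    obtain ⟨hc, hl, hr⟩ := nfAtoms_node.1 h
    simp only [BTree.subst, interp, evalTm_iteT, ihl hl, ihr hr,
      DTree.val_evalTm_substAll ha' hv hc]

theorem NfAtoms.exists_leaf_nf_subst {prec : FSym → FSym → Prop} {su : Tm → Tm → Prop}
    (hsu : SuOK su) {v : Tm → Bool} (hb : BoolVal v) {a a' : Tm} (ha' : NfIfFree a')
    (hv : v a' = v a) {B : BTree} (h : B.NfAtoms) :
    ∃ w, IsNfOf prec su (B.subst a a').interp w ∧ Leaf w (evalTm v B.interp) := by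
  have hs := (h.subst (a := a) ha').iteTerm
  obtain ⟨d, hd, e⟩ := hs.exists_reduced (prec := prec) hsu
  refine ⟨d.interp, ⟨e, hd.not_rw hsu⟩, ?_⟩
  rw [← h.evalTm_subst ha' hv, ← (reflTransGen_rw_preserves e hs).2 v hb]
  exact leaf_evalTm v hd.iteTerm

end BTree

end Substitution

/-- splitting on a shared conditional.  Let
s ≡ B[(Cᵢ[a⃗ᵢ,a ⋄ b⃗ᵢ,a])ᵢ ⋄ (Dⱼ[c⃗ⱼ,a ⋄ t⃗ⱼ])ⱼ] where all the displayed atoms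
are if-free and in R-normal form (and a does not occur among the non-displayed
atoms a⃗ᵢ, b⃗ᵢ, c⃗ⱼ, which is captured by replacing *every* occurrence of a at
the corresponding positions).  If t ∈ leaves(s↓_R) then t ∈ leaves(s_true↓_R)
or t ∈ leaves(s_false↓_R), where s_true (s_false) replaces every displayed
occurrence of a by true (false). -/
theorem stmt13
    (prec : FSym → FSym → Prop) (hprec : PrecOK prec)
    (su : Tm → Tm → Prop) (hsu : SuOK su)
    (a : Tm) (ha : NfIfFree a) (B : BTree)
    (hatoms : ∀ d : DTree, (d ∈ B.guards ∨ d ∈ B.leaves) →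
      ∀ x ∈ d.atoms, NfIfFree x)
    (t : Tm)
    (ht : ∃ w, IsNfOf prec su B.interp w ∧ Leaf w t) :
    (∃ w, IsNfOf prec su ((B.subst a trueT).interp) w ∧ Leaf w t) ∨
    (∃ w, IsNfOf prec su ((B.subst a falseT).interp) w ∧ Leaf w t) := by
  obtain ⟨w, ⟨hred, hnf⟩, hleaf⟩ := ht
  have hB : B.NfAtoms := hatoms
  obtain ⟨hw, hev⟩ := reflTransGen_rw_preserves hred hB.iteTerm
  obtain ⟨d, hd, rfl⟩ := hw.exists_reduced_eq hsu hnf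
  classical
  obtain ⟨v, hv, -, rfl⟩ := hd.exists_evalTm_eq hsu hleaf (fun x => decide (x = trueT))
    ⟨by simp, by simp [trueT, falseT]⟩
  rw [hev v hv]
  cases hva : v a
  · exact .inr (hB.exists_leaf_nf_subst hsu hv nfIfFree_falseT (hv.2.trans hva.symm))
  · exact .inl (hB.exists_leaf_nf_subst hsu hv nfIfFree_trueT (hv.1.trans hva.symm))
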